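/- Let (G, P, θ) be an algebraic dynamical system and S = G ⋊_θ P. A finite subset F ⊂ S is a foundation set for S if and only if there exists a foundation set P_F for P such that for every q ∈ P_F, G = ⋃ { h'θ_{q'}(G) : (h',q') ∈ F, q' ≤ q }, where q' ≤ q means q ∈ q'P. -/

import Mathlib

variable {G : Type*} [Group G] {P : Type*} [Monoid P]

/-- The principal right ideal `pP` in the monoid `P`. -/
def idealP (p : P) : Set P := {x | ∃ t, x = p * t}

/-- Multiplication in the semidirect product `S = G ⋊_θ P`:
`(g,p)(h,q) = (g·θ_p(h), pq)`. -/
def smulS (θ : P → G →* G) (s t : G × P) : G × P := (s.1 * θ s.2 t.1, s.2 * t.2)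

/-- The principal right ideal `sS` in `S = G ⋊_θ P`. -/
def idealS (θ : P → G →* G) (s : G × P) : Set (G × P) := {x | ∃ t, x = smulS θ s t}

/-- Foundation set for `P`. -/
def FoundP (F : Set P) : Prop :=
  F.Finite ∧ ∀ p : P, ∃ q ∈ F, (idealP p ∩ idealP q).Nonempty

/-- Accurate set in `P`: distinct elements have disjoint principal right ideals. -/
def AccP (F : Set P) : Prop :=
  ∀ p ∈ F, ∀ q ∈ F, p ≠ q → idealP p ∩ idealP q = ∅

/-- Foundation set for `S = G ⋊_θ P`. -/
def FoundS (θ : P → G →* G) (F : Set (G × P)) : Prop :=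
  F.Finite ∧ ∀ s : G × P, ∃ t ∈ F, (idealS θ s ∩ idealS θ t).Nonempty

/-- Accurate set in `S = G ⋊_θ P`. -/
def AccS (θ : P → G →* G) (F : Set (G × P)) : Prop :=
  ∀ s ∈ F, ∀ t ∈ F, s ≠ t → idealS θ s ∩ idealS θ t = ∅

theorem mem_idealP_self (p : P) : p ∈ idealP p := ⟨1, (mul_one p).symm⟩

theorem mul_mem_idealP {p x : P} (hx : x ∈ idealP p) (t : P) : x * t ∈ idealP p := by
  obtain ⟨u, rfl⟩ := hx
  exact ⟨u * t, mul_assoc p u t⟩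

theorem idealP_subset {p x : P} (hx : x ∈ idealP p) : idealP x ⊆ idealP p := by
  rintro _ ⟨t, rfl⟩
  exact mul_mem_idealP hx t

/-- Two principal right ideals of `G ⋊_θ P` meet iff their components do. -/
theorem idealS_inter_nonempty_iff (θ : P → G →* G) (s t : G × P) :
    (idealS θ s ∩ idealS θ t).Nonempty ↔
      (∃ a b : G, s.1 * θ s.2 a = t.1 * θ t.2 b) ∧
        (idealP s.2 ∩ idealP t.2).Nonempty := by
  constructor
  · rintro ⟨_, ⟨a, rfl⟩, b, hb⟩
    exact ⟨⟨a.1, b.1, congrArg Prod.fst hb⟩, s.2 * a.2, ⟨a.2, rfl⟩, b.2, congrArg Prod.snd hb⟩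
  · rintro ⟨⟨a, b, hab⟩, _, ⟨u, rfl⟩, v, hv⟩
    exact ⟨smulS θ s (a, u), ⟨_, rfl⟩, (b, v), Prod.ext hab hv⟩

/-- In a right LCM monoid, a finite family with a common right multiple has a least one. -/
theorem exists_lcm_of_finite {ι : Type*}
    (hLCM : ∀ p q : P, idealP p ∩ idealP q = ∅ ∨ ∃ r : P, idealP p ∩ idealP q = idealP r)
    (f : ι → P) {A : Set ι} (hA : A.Finite) {x : P} (hx : ∀ t ∈ A, x ∈ idealP (f t)) :
    ∃ r : P, x ∈ idealP r ∧ (∀ t ∈ A, r ∈ idealP (f t)) ∧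
      ∀ y, (∀ t ∈ A, y ∈ idealP (f t)) → y ∈ idealP r := by
  induction A, hA using Set.Finite.induction_on with
  | empty => exact ⟨1, ⟨x, (one_mul x).symm⟩, by simp, fun y _ => ⟨y, (one_mul y).symm⟩⟩
  | @insert a A _ _ ih =>
    obtain ⟨r, hxr, hr, hmin⟩ := ih fun t ht => hx t (Set.mem_insert_of_mem a ht)
    have hxa := hx a (Set.mem_insert a A)
    rcases hLCM (f a) r with h | ⟨w, hw⟩
    · exact absurd (show x ∈ idealP (f a) ∩ idealP r from ⟨hxa, hxr⟩) (by simp [h])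
    · have hmem : w ∈ idealP (f a) ∩ idealP r := hw ▸ mem_idealP_self w
      refine ⟨w, hw ▸ ⟨hxa, hxr⟩, ?_, fun y hy => hw ▸ ⟨hy a (Set.mem_insert a A),
        hmin y fun t ht => hy t (Set.mem_insert_of_mem a ht)⟩⟩
      rintro t (rfl | ht)
      · exact hmem.1
      · exact idealP_subset (hr t ht) hmem.2

/-- Every `p` has a right multiple `x` that is a right multiple of each `f t`, `t ∈ F`, with which
it has a common right multiple. -/
theorem exists_mem_idealP_saturated {ι : Type*} (f : ι → P) {F : Set ι} (hF : F.Finite) (p : P) :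
    ∃ x ∈ idealP p, ∀ t ∈ F, (idealP x ∩ idealP (f t)).Nonempty → x ∈ idealP (f t) := by
  let C : Set (Set ι) := {A | A ⊆ F ∧ ∃ x ∈ idealP p, ∀ t ∈ A, x ∈ idealP (f t)}
  have hC : C.Finite := hF.finite_subsets.subset fun A hA => hA.1
  obtain ⟨A, ⟨hAF, x, hxp, hxA⟩, hmax⟩ := hC.exists_maximal
    ⟨∅, Set.empty_subset F, p, mem_idealP_self p, by simp⟩
  refine ⟨x, hxp, fun t ht ⟨y, hyx, hyt⟩ => hxA t ?_⟩
  refine hmax (y := insert t A) ⟨Set.insert_subset ht hAF, y, idealP_subset hxp hyx, ?_⟩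
    (Set.subset_insert t A) (Set.mem_insert t A)
  rintro u (rfl | hu)
  · exact hyt
  · exact idealP_subset (hxA u hu) hyx

/-- A finite `F ⊆ G ⋊_θ P` is a foundation set for `S` iff there is a foundation
set `P_F` for `P` such that for every `q ∈ P_F`,
`G = ⋃ { h'θ_{q'}(G) : (h',q') ∈ F, q' ≤ q }`. -/
theorem stmt7 (θ : P → G →* G)
    (hone : θ 1 = MonoidHom.id G)
    (hmul : ∀ p q : P, θ (p * q) = (θ p).comp (θ q))
    (hinj : ∀ p : P, Function.Injective (θ p))
    (hLCM : ∀ p q : P, idealP p ∩ idealP q = ∅ ∨ ∃ r : P, idealP p ∩ idealP q = idealP r)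
    (hcompat : ∀ p q r : P, idealP p ∩ idealP q = idealP r →
      (θ p).range ⊓ (θ q).range = (θ r).range)
    (F : Set (G × P)) (hF : F.Finite) :
    FoundS θ F ↔
      ∃ PF : Set P, FoundP PF ∧
        ∀ q ∈ PF, ∀ g : G, ∃ t ∈ F, q ∈ idealP t.2 ∧ ∃ m : G, g = t.1 * θ t.2 m := by
  constructor
  · rintro ⟨-, hS⟩
    choose! r hr using fun (A : Set (G × P))
      (hA : A ⊆ F ∧ ∃ x : P, ∀ t ∈ A, x ∈ idealP t.2) =>
        exists_lcm_of_finite hLCM Prod.snd (hF.subset hA.1) hA.2.choose_spec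
    refine ⟨{q | q ∈ r '' {A | A ⊆ F} ∧
      ∀ g : G, ∃ t ∈ F, q ∈ idealP t.2 ∧ ∃ m : G, g = t.1 * θ t.2 m},
      ⟨(hF.finite_subsets.image r).subset fun q hq => hq.1, fun p => ?_⟩, fun q hq => hq.2⟩
    obtain ⟨x, hxp, hx⟩ := exists_mem_idealP_saturated Prod.snd hF p
    let A : Set (G × P) := {t ∈ F | x ∈ idealP t.2}
    have hxA : ∀ t ∈ A, x ∈ idealP t.2 := fun t ht => ht.2
    obtain ⟨-, hrA, hmin⟩ := hr A ⟨fun t ht => ht.1, x, hxA⟩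
    refine ⟨r A, ⟨⟨A, fun t ht => ht.1, rfl⟩, fun g => ?_⟩, x, hxp, hmin x hxA⟩
    obtain ⟨t, ht, hst⟩ := hS (g, x)
    obtain ⟨⟨a, b, hab⟩, hne⟩ := (idealS_inter_nonempty_iff θ (g, x) t).1 hst
    have hxt := hx t ht hne
    refine ⟨t, ht, hrA t ⟨ht, hxt⟩, ?_⟩
    obtain ⟨u, hu⟩ := hxt
    refine ⟨b * (θ u a)⁻¹, ?_⟩
    have hθ : θ x a = θ t.2 (θ u a) := by rw [hu, hmul]; rfl
    rw [map_mul, map_inv, ← hθ, ← mul_assoc]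
    exact eq_mul_inv_of_mul_eq hab
  · rintro ⟨PF, ⟨-, hPF⟩, hcov⟩
    refine ⟨hF, fun s => ?_⟩
    obtain ⟨q, hq, y, hys, hyq⟩ := hPF s.2
    obtain ⟨t, ht, hqt, m, hm⟩ := hcov q hq s.1
    exact ⟨t, ht, (idealS_inter_nonempty_iff θ s t).2
      ⟨⟨1, m, by rw [map_one, mul_one, hm]⟩, y, hys, idealP_subset hqt hyq⟩⟩
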